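/- Let m, q, t, N be positive integers with m/2 < t ≤ m, q/2 < N − 1, and N ≤ q. Let S ⊆ P(q − N), and set Y := B_q(N−1) ∪ {(N, ν) : ν ∈ S}° and X := B_m(t) ⋆ Y. Then: (i) B_{m+q}(t+N−1) ⊆ X ⊆ B_{m+q}(t+N); and (ii) for every partition μ of (m−t) + (q−N), the partition (t+N, μ) (first part t+N followed by the parts of μ) belongs to X if and only if μ ∈ P(m−t) ⋆ S, where in the degenerate case m = t this condition is interpreted as μ ∈ S. -/

import Mathlib

open scoped Classical

namespace SylowBranching

/-- The cells of the Young diagram of `f` (rows indexed by the first coordinate,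
starting from `0`; `f i` is the length of row `i`). -/
def cellsOf (f : ℕ → ℕ) : Set (ℕ × ℕ) := {p | p.2 < f p.1}

/-- `f : ℕ → ℕ` is a partition if it is weakly decreasing with finitely many
nonzero parts.  Its parts are `f 0 ≥ f 1 ≥ ⋯`, and its largest part is `f 0`. -/
def IsPartition (f : ℕ → ℕ) : Prop :=
  Antitone f ∧ ∃ N, ∀ i, N ≤ i → f i = 0

/-- The size `|f|` of a partition: the number of cells of its Young diagram. -/
noncomputable def psize (f : ℕ → ℕ) : ℕ := (cellsOf f).ncard

/-- `P(n)`: the set of partitions of `n`. -/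
def Pset (n : ℕ) : Set (ℕ → ℕ) := {f | IsPartition f ∧ psize f = n}

/-- The conjugate (transpose) partition `f'`. -/
noncomputable def conj (f : ℕ → ℕ) : ℕ → ℕ := fun j => Set.ncard {i | j < f i}

/-- `A° = A ∪ A'`: the closure of a set of partitions under conjugation. -/
noncomputable def conjClosure (A : Set (ℕ → ℕ)) : Set (ℕ → ℕ) := A ∪ conj '' A

/-- `B_n(t)`: partitions of `n` with largest part at most `t` and at most `t` parts. -/
noncomputable def Bset (n t : ℕ) : Set (ℕ → ℕ) :=
  {f ∈ Pset n | f 0 ≤ t ∧ conj f 0 ≤ t}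

/-- The cells of the skew shape `l / m`. -/
def skewCells (l m : ℕ → ℕ) : Set (ℕ × ℕ) :=
  {p | m p.1 ≤ p.2 ∧ p.2 < l p.1}

/-- `d` is read before (or at the same time as) `c` in the reading order of a
filling: right-to-left along rows, rows from top to bottom. -/
def readBefore (d c : ℕ × ℕ) : Prop :=
  d.1 < c.1 ∨ (d.1 = c.1 ∧ c.2 ≤ d.2)

/-- A Littlewood–Richardson filling of the cell set `γ` of weight `ν`:
all entries are positive; for every `j ≥ 1` there are exactly `ν (j-1)` entries
equal to `j` (i.e. the number of `j`s is the `j`-th part of `ν`); entries weakly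
increase along rows and strictly increase down columns; and every initial
segment of the reading word (right-to-left along rows, top to bottom) contains
at least as many entries equal to `j` as entries equal to `j+1`, for all `j ≥ 1`. -/
structure IsLRFilling (γ : Set (ℕ × ℕ)) (ν : ℕ → ℕ) (T : ℕ × ℕ → ℕ) : Prop where
  pos : ∀ c ∈ γ, 1 ≤ T c
  weight : ∀ j : ℕ, 1 ≤ j → Set.ncard {c ∈ γ | T c = j} = ν (j - 1)
  row_weak : ∀ i j j', (i, j) ∈ γ → (i, j') ∈ γ → j ≤ j' → T (i, j) ≤ T (i, j')
  col_strict : ∀ i i' j, (i, j) ∈ γ → (i', j) ∈ γ → i < i' → T (i, j) < T (i', j)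
  lattice : ∀ c ∈ γ, ∀ j : ℕ, 1 ≤ j →
    Set.ncard {d ∈ γ | T d = j + 1 ∧ readBefore d c} ≤
      Set.ncard {d ∈ γ | T d = j ∧ readBefore d c}

/-- `LR(γ)`: the set of all weights of LR fillings of `γ`. -/
def LRset (γ : Set (ℕ × ℕ)) : Set (ℕ → ℕ) := {ν | ∃ T, IsLRFilling γ ν T}

/-- The Littlewood–Richardson coefficient `c^l_{m ν}`: the number of LR fillings
of the skew shape `l / m` of weight `ν` (zero unless `m ⊆ l`); fillings are
normalised to vanish off the skew shape so that they can be counted. -/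
noncomputable def LRcoeff (l m ν : ℕ → ℕ) : ℕ :=
  Set.ncard {T : ℕ × ℕ → ℕ |
    (∀ i, m i ≤ l i) ∧ (∀ c, c ∉ skewCells l m → T c = 0) ∧
      IsLRFilling (skewCells l m) ν T}

/-- The `⋆` operation on sets of partitions:
`A ⋆ B = {λ : c^λ_{μν} > 0 for some μ ∈ A, ν ∈ B}`. -/
def starOp (A B : Set (ℕ → ℕ)) : Set (ℕ → ℕ) :=
  {l | IsPartition l ∧ ∃ μ ∈ A, ∃ ν ∈ B, 0 < LRcoeff l μ ν}

/-- The partition with the given (weakly decreasing) list of parts. -/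
def ofList (L : List ℕ) : ℕ → ℕ := fun i => L.getD i 0

/-- The hook partition `(a, 1^b)`. -/
def hookP (a b : ℕ) : ℕ → ℕ := ofList (a :: List.replicate b 1)

/-- The partition `(a, μ)` obtained by prepending a first part `a` to `μ`. -/
def consPart (a : ℕ) (μ : ℕ → ℕ) : ℕ → ℕ := fun i => if i = 0 then a else μ (i - 1)

/-- `γ` coincides, up to planar translation, with the Young diagram of `ν`. -/
def TranslateOf (γ : Set (ℕ × ℕ)) (ν : ℕ → ℕ) : Prop :=
  ∃ a b : ℕ, γ = (fun p : ℕ × ℕ => (p.1 + a, p.2 + b)) '' cellsOf ν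

/-- `γ` coincides, up to planar translation, with the 180°-rotation of the
Young diagram of `ν`. -/
def RotationOf (γ : Set (ℕ × ℕ)) (ν : ℕ → ℕ) : Prop :=
  ∃ a b : ℕ, (∀ p ∈ cellsOf ν, p.1 ≤ a ∧ p.2 ≤ b) ∧
    γ = (fun p : ℕ × ℕ => (a - p.1, b - p.2)) '' cellsOf ν

/-- Iterated Littlewood–Richardson coefficients `c^l_{μ^1, …, μ^r}`:
`c^l_{μ} = δ_{l μ}`, and the coefficient for a longer list is obtained by
summing, over partitions `g` of the total size of the remaining factors, the
product of the iterated coefficient of `g` with `c^l_{g μ}`. -/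
noncomputable def iterLR : List (ℕ → ℕ) → (ℕ → ℕ) → ℕ
  | [], l => if l = (fun _ => 0 : ℕ → ℕ) then 1 else 0
  | [μ], l => if l = μ then 1 else 0
  | μ :: μs, l =>
      ∑' g : {g : ℕ → ℕ // IsPartition g ∧ psize g = (μs.map psize).sum},
        iterLR μs g.1 * LRcoeff l g.1 μ

/-- `D(q, m, B)`: partitions `λ` of `qm` with `c^λ_{μ_1, …, μ_q} > 0` for some
`μ_1, …, μ_q ∈ B` that are not all equal. -/
noncomputable def Dset (q m : ℕ) (B : Set (ℕ → ℕ)) : Set (ℕ → ℕ) :=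
  {l ∈ Pset (q * m) | ∃ μ : Fin q → (ℕ → ℕ),
    (∀ i, μ i ∈ B) ∧ (∃ i j, μ i ≠ μ j) ∧ 0 < iterLR (List.ofFn μ) l}

/-- Iterated `⋆` of a list of sets of partitions. -/
def starAll : List (Set (ℕ → ℕ)) → Set (ℕ → ℕ)
  | [] => Pset 0
  | [A] => A
  | A :: B :: rest => starOp A (starAll (B :: rest))

/-- `Ω(φ(1,0,…,0))` for the Sylow 3-subgroup of `S_{3^k}` (`k ≥ 4`):
`B_{3^k}(2a) ∖ {(2a, a−1, 1), (2a, 2, 1^{a−2}), (2a−1, a+1), (2a−1, 1^{a+1})}°`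
where `a = 3^{k−1}`. -/
noncomputable def Cset (k : ℕ) : Set (ℕ → ℕ) :=
  Bset (3 ^ k) (2 * 3 ^ (k - 1)) \
    conjClosure
      {ofList [2 * 3 ^ (k - 1), 3 ^ (k - 1) - 1, 1],
       ofList (2 * 3 ^ (k - 1) :: 2 :: List.replicate (3 ^ (k - 1) - 2) 1),
       ofList [2 * 3 ^ (k - 1) - 1, 3 ^ (k - 1) + 1],
       hookP (2 * 3 ^ (k - 1) - 1) (3 ^ (k - 1) + 1)}

/-! ### Cell counts and sizes -/

lemma band_eq_coe (K : ℕ) (l u : ℕ → ℕ) :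
    {p : ℕ × ℕ | p.1 < K ∧ l p.1 ≤ p.2 ∧ p.2 < u p.1} =
      ↑((Finset.range K).biUnion fun i => (Finset.Ico (l i) (u i)).image (Prod.mk i)) := by
  ext ⟨i, j⟩
  simp
  tauto

lemma finite_band (K : ℕ) (l u : ℕ → ℕ) :
    {p : ℕ × ℕ | p.1 < K ∧ l p.1 ≤ p.2 ∧ p.2 < u p.1}.Finite := by
  rw [band_eq_coe]
  exact Finset.finite_toSet _

/-- The number of cells in the first `K` rows lying between two boundaries. -/
lemma ncard_band (K : ℕ) (l u : ℕ → ℕ) :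
    {p : ℕ × ℕ | p.1 < K ∧ l p.1 ≤ p.2 ∧ p.2 < u p.1}.ncard =
      ∑ i ∈ Finset.range K, (u i - l i) := by
  rw [band_eq_coe, Set.ncard_coe_finset, Finset.card_biUnion]
  · refine Finset.sum_congr rfl fun i _ => ?_
    rw [Finset.card_image_of_injective _ (Prod.mk_right_injective i), Nat.card_Ico]
  · intro i _ j _ hij
    rw [Function.onFun, Finset.disjoint_left]
    rintro ⟨a, b⟩ h h'
    simp only [Finset.mem_image, Prod.mk.injEq] at h h'
    obtain ⟨_, _, rfl, _⟩ := h
    obtain ⟨_, _, rfl, _⟩ := h'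
    exact hij rfl

lemma cellsOf_eq_band {f : ℕ → ℕ} {K : ℕ} (hf : ∀ i, K ≤ i → f i = 0) :
    cellsOf f = {p : ℕ × ℕ | p.1 < K ∧ 0 ≤ p.2 ∧ p.2 < f p.1} := by
  ext ⟨i, j⟩
  simp only [cellsOf, Set.mem_ofPred_eq]
  constructor
  · intro h
    refine ⟨?_, by omega, h⟩
    by_contra hi
    have := hf i (by omega)
    omega
  · exact fun h => h.2.2

lemma psize_eq_sum {f : ℕ → ℕ} {K : ℕ} (hf : ∀ i, K ≤ i → f i = 0) :
    psize f = ∑ i ∈ Finset.range K, f i := by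
  rw [psize, cellsOf_eq_band hf]
  exact ncard_band K (fun _ => 0) f

lemma IsPartition.finite_cellsOf {f : ℕ → ℕ} (hf : IsPartition f) : (cellsOf f).Finite := by
  obtain ⟨-, K, hK⟩ := hf
  rw [cellsOf_eq_band hK]
  exact finite_band K (fun _ => 0) f

lemma finite_skewCells {l : ℕ → ℕ} (hl : IsPartition l) (m : ℕ → ℕ) :
    (skewCells l m).Finite :=
  hl.finite_cellsOf.subset fun _ hp => hp.2

lemma IsPartition.apply_zero_le_psize {f : ℕ → ℕ} (hf : IsPartition f) : f 0 ≤ psize f := by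
  obtain ⟨-, K, hK⟩ := hf
  rw [psize_eq_sum (K := K + 1) fun i hi => hK i (by omega)]
  exact Finset.single_le_sum (f := f) (fun _ _ => Nat.zero_le _) (by simp)

lemma IsPartition.eq_zero_of_psize_le {f : ℕ → ℕ} (hf : IsPartition f) {i : ℕ}
    (hi : psize f ≤ i) : f i = 0 := by
  obtain ⟨ha, K, hK⟩ := hf
  by_contra h
  have hiK : i < K := by
    by_contra hK'
    exact h (hK i (by omega))
  rw [psize_eq_sum hK] at hi
  have h1 : ∑ j ∈ Finset.range (i + 1), 1 ≤ ∑ j ∈ Finset.range (i + 1), f j :=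
    Finset.sum_le_sum fun j hj => by
      have := ha (show j ≤ i by simp at hj; omega)
      omega
  have h2 : ∑ j ∈ Finset.range (i + 1), f j ≤ ∑ j ∈ Finset.range K, f j :=
    Finset.sum_le_sum_of_subset (by simpa using hiK)
  simp at h1
  omega

/-! ### Conjugation -/

lemma IsPartition.lt_conj_iff {f : ℕ → ℕ} (hf : IsPartition f) (i j : ℕ) :
    i < conj f j ↔ j < f i := by
  obtain ⟨ha, K, hK⟩ := hf
  obtain ⟨L, hL⟩ : ∃ L, ∀ i, j < f i ↔ i < L := by
    have hex : ∃ L, f L ≤ j := ⟨K, by simp [hK K le_rfl]⟩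
    refine ⟨Nat.find hex, fun i => ?_⟩
    rw [Nat.lt_find_iff]
    constructor
    · intro h r hr
      have := ha hr
      omega
    · intro h
      have := h i le_rfl
      omega
  have : conj f j = L := by
    have : {i | j < f i} = ↑(Finset.range L) := by ext i; simp [hL]
    rw [conj, this, Set.ncard_coe_finset, Finset.card_range]
  rw [this, hL]

lemma IsPartition.conj_zero_le_iff {f : ℕ → ℕ} (hf : IsPartition f) (t : ℕ) :
    conj f 0 ≤ t ↔ ∀ i, t ≤ i → f i = 0 := by
  constructor
  · intro h i hi
    have := hf.lt_conj_iff i 0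
    omega
  · intro h
    by_contra hc
    have := (hf.lt_conj_iff t 0).1 (by omega)
    have := h t le_rfl
    omega

lemma IsPartition.conj {f : ℕ → ℕ} (hf : IsPartition f) : IsPartition (conj f) := by
  constructor
  · intro i j hij
    by_contra hc
    have h1 := (hf.lt_conj_iff (SylowBranching.conj f i) j).1 (by omega)
    have h2 := hf.lt_conj_iff (SylowBranching.conj f i) i
    omega
  · refine ⟨f 0, fun i hi => ?_⟩
    have := hf.lt_conj_iff 0 i
    omega

lemma IsPartition.psize_conj {f : ℕ → ℕ} (hf : IsPartition f) :
    psize (SylowBranching.conj f) = psize f := by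
  have : cellsOf (SylowBranching.conj f) = Prod.swap '' cellsOf f := by
    ext ⟨i, j⟩
    simp [cellsOf, hf.lt_conj_iff]
  rw [psize, this, Set.ncard_image_of_injective _ Prod.swap_injective, psize]

lemma IsPartition.conj_conj {f : ℕ → ℕ} (hf : IsPartition f) :
    SylowBranching.conj (SylowBranching.conj f) = f := by
  funext i
  refine le_antisymm ?_ ?_ <;> by_contra hc
  · have := hf.conj.lt_conj_iff (f i) i
    have := hf.lt_conj_iff i (f i)
    omega
  · have := hf.conj.lt_conj_iff (SylowBranching.conj (SylowBranching.conj f) i) i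
    have := hf.lt_conj_iff i (SylowBranching.conj (SylowBranching.conj f) i)
    omega

lemma mem_Bset_iff {n t : ℕ} {f : ℕ → ℕ} :
    f ∈ Bset n t ↔ IsPartition f ∧ psize f = n ∧ f 0 ≤ t ∧ ∀ i, t ≤ i → f i = 0 := by
  simp only [Bset, Pset, Set.mem_ofPred_eq, and_assoc]
  constructor
  · rintro ⟨h, h1, h2, h3⟩
    exact ⟨h, h1, h2, (h.conj_zero_le_iff t).1 h3⟩
  · rintro ⟨h, h1, h2, h3⟩
    exact ⟨h, h1, h2, (h.conj_zero_le_iff t).2 h3⟩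

lemma conj_mem_Bset {n t : ℕ} {f : ℕ → ℕ} (hf : f ∈ Bset n t) : conj f ∈ Bset n t := by
  obtain ⟨⟨h, h1⟩, h2, h3⟩ := hf
  exact ⟨⟨h.conj, h.psize_conj.trans h1⟩, h3, by rwa [h.conj_conj]⟩

/-! ### Adding a first row or a column -/

@[simp]
lemma consPart_zero (a : ℕ) (f : ℕ → ℕ) : consPart a f 0 = a := rfl

@[simp]
lemma consPart_succ (a : ℕ) (f : ℕ → ℕ) (i : ℕ) : consPart a f (i + 1) = f i := rfl

lemma IsPartition.consPart {f : ℕ → ℕ} (hf : IsPartition f) {a : ℕ} (ha : f 0 ≤ a) :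
    IsPartition (consPart a f) := by
  obtain ⟨h, K, hK⟩ := hf
  constructor
  · refine antitone_nat_of_succ_le fun i => ?_
    cases i with
    | zero => simpa using ha
    | succ i => simpa using h (Nat.le_succ i)
  · refine ⟨K + 1, fun i hi => ?_⟩
    obtain ⟨i, rfl⟩ : ∃ r, i = r + 1 := ⟨i - 1, by omega⟩
    simpa using hK i (by omega)

lemma IsPartition.tail {f : ℕ → ℕ} (hf : IsPartition f) : IsPartition fun i => f (i + 1) := by
  obtain ⟨h, K, hK⟩ := hf
  exact ⟨fun i j hij => h (by omega), K, fun i hi => hK _ (by omega)⟩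

lemma consPart_tail (f : ℕ → ℕ) : consPart (f 0) (fun i => f (i + 1)) = f := by
  funext i
  cases i <;> rfl

lemma psize_consPart {f : ℕ → ℕ} (hf : IsPartition f) (a : ℕ) :
    psize (consPart a f) = a + psize f := by
  obtain ⟨-, K, hK⟩ := hf
  rw [psize_eq_sum hK, psize_eq_sum (K := K + 1), Finset.sum_range_succ']
  · simp [add_comm]
  · intro i hi
    obtain ⟨i, rfl⟩ : ∃ r, i = r + 1 := ⟨i - 1, by omega⟩
    simpa using hK i (by omega)

/-- Prepending a part `t` to any partition of `m - t` gives an element of `B_m(t)`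
when `m < 2 * t`. -/
lemma consPart_mem_Bset {m t : ℕ} (htm : t ≤ m) (hmt : m < 2 * t) {f : ℕ → ℕ}
    (hf : IsPartition f) (hs : psize f = m - t) : consPart t f ∈ Bset m t := by
  have h0 := hf.apply_zero_le_psize
  refine mem_Bset_iff.2 ⟨hf.consPart (by omega), ?_, le_rfl, fun i hi => ?_⟩
  · rw [psize_consPart hf]
    omega
  · obtain ⟨i, rfl⟩ : ∃ r, i = r + 1 := ⟨i - 1, by omega⟩
    exact hf.eq_zero_of_psize_le (by omega)

/-- The partition `(1^x)`. -/
def column (x : ℕ) : ℕ → ℕ := fun i => if i < x then 1 else 0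

lemma isPartition_zero : IsPartition 0 := ⟨antitone_const, 0, fun _ _ => rfl⟩

lemma psize_zero : psize 0 = 0 := by
  simp [psize_eq_sum (f := 0) (K := 0)]

lemma IsPartition.add_column {f : ℕ → ℕ} (hf : IsPartition f) (x : ℕ) :
    IsPartition (f + column x) := by
  obtain ⟨h, K, hK⟩ := hf
  refine ⟨fun i j hij => ?_, K + x, fun i hi => ?_⟩
  · have := h hij
    simp only [Pi.add_apply, column]
    split_ifs <;> omega
  · simp [column, hK i (by omega)]
    omega

lemma psize_add_column {f : ℕ → ℕ} (hf : IsPartition f) (x : ℕ) :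
    psize (f + column x) = psize f + x := by
  obtain ⟨h, K, hK⟩ := hf
  rw [psize_eq_sum (f := f) (K := K + x) fun i hi => hK i (by omega),
    psize_eq_sum (K := K + x)]
  · have : (Finset.range (K + x)).filter (· < x) = Finset.range x := by
      ext i
      simp
      omega
    simp [Finset.sum_add_distrib, column, this]
  · intro i hi
    simp [column, hK i (by omega)]
    omega

/-- Adding a column of length `t` to any partition of `m - t` gives an element of `B_m(t)`
when `m < 2 * t`. -/
lemma add_column_mem_Bset {m t : ℕ} (htm : t ≤ m) (hmt : m < 2 * t) {f : ℕ → ℕ}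
    (hf : IsPartition f) (hs : psize f = m - t) : f + column t ∈ Bset m t := by
  have h0 := hf.apply_zero_le_psize
  refine mem_Bset_iff.2 ⟨hf.add_column t, ?_, ?_, fun i hi => ?_⟩
  · rw [psize_add_column hf]
    omega
  · simp only [Pi.add_apply, column]
    split_ifs <;> omega
  · have := hf.eq_zero_of_psize_le (i := i) (by omega)
    simp only [Pi.add_apply, column]
    split_ifs <;> omega

/-! ### Littlewood–Richardson fillings -/

namespace IsLRFilling

variable {γ : Set (ℕ × ℕ)} {ν : ℕ → ℕ} {T : ℕ × ℕ → ℕ}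

lemma apply_pos_of_mem (h : IsLRFilling γ ν T) (hγ : γ.Finite) {c : ℕ × ℕ} (hc : c ∈ γ) :
    0 < ν (T c - 1) := by
  rw [← h.weight (T c) (h.pos c hc)]
  exact (Set.ncard_pos (hγ.subset fun _ hd => hd.1)).2 ⟨c, hc, rfl⟩

lemma le_of_forall_eq_zero (h : IsLRFilling γ ν T) (hγ : γ.Finite) {L : ℕ}
    (hL : ∀ i, L ≤ i → ν i = 0) {c : ℕ × ℕ} (hc : c ∈ γ) : T c ≤ L := by
  by_contra hcL
  have h1 := h.apply_pos_of_mem hγ hc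
  have h2 := hL (T c - 1) (by omega)
  omega

/-- Entries in row `i` (counted from `0`) of a Littlewood–Richardson filling are at most `i + 1`. -/
lemma le_row (h : IsLRFilling γ ν T) (hγ : γ.Finite) :
    ∀ i j, (i, j) ∈ γ → T (i, j) ≤ i + 1 := by
  intro i
  induction i using Nat.strong_induction_on with
  | _ i ih =>
    intro j hc
    by_contra hT
    obtain ⟨r, hr⟩ : ∃ r, T (i, j) = r + 1 := ⟨T (i, j) - 1, by omega⟩
    have hlat := h.lattice (i, j) hc r (by omega)
    have hpos : 0 < Set.ncard {d ∈ γ | T d = r + 1 ∧ readBefore d (i, j)} :=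
      (Set.ncard_pos (hγ.subset fun _ hd => hd.1)).2 ⟨(i, j), hc, hr, Or.inr ⟨rfl, le_rfl⟩⟩
    obtain ⟨⟨i', j'⟩, hd, hTd, hb⟩ :=
      (Set.ncard_pos (hγ.subset fun _ hd => hd.1)).1 (hpos.trans_le hlat)
    rcases hb with hlt | ⟨heq, hle⟩
    · have := ih i' hlt j' hd
      simp only at hlt
      omega
    · simp only at heq hle
      subst heq
      have := h.row_weak i' j j' hc hd hle
      omega

lemma congr {T' : ℕ × ℕ → ℕ} (h : IsLRFilling γ ν T) (hT : ∀ c ∈ γ, T' c = T c) :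
    IsLRFilling γ ν T' where
  pos c hc := by rw [hT c hc]; exact h.pos c hc
  weight j hj := by
    rw [← h.weight j hj]
    congr 1
    ext c
    exact and_congr_right fun hc => by rw [hT c hc]
  row_weak i j j' hc hc' hjj' := by rw [hT _ hc, hT _ hc']; exact h.row_weak i j j' hc hc' hjj'
  col_strict i i' j hc hc' hii' := by
    rw [hT _ hc, hT _ hc']; exact h.col_strict i i' j hc hc' hii'
  lattice c hc j hj := by
    have key : ∀ k, {d ∈ γ | T' d = k ∧ readBefore d c} = {d ∈ γ | T d = k ∧ readBefore d c} := by
      intro k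
      ext d
      exact and_congr_right fun hd => by rw [hT d hd]
    rw [key, key]
    exact h.lattice c hc j hj

end IsLRFilling

/-- Positivity of a Littlewood–Richardson coefficient amounts to the existence of a filling. -/
lemma LRcoeff_pos_iff {l m ν : ℕ → ℕ} (hl : IsPartition l) (hν : IsPartition ν) :
    0 < LRcoeff l m ν ↔ (∀ i, m i ≤ l i) ∧ ∃ T, IsLRFilling (skewCells l m) ν T := by
  have hγ := finite_skewCells hl m
  obtain ⟨-, L, hL⟩ := hν
  have hfin : {T : ℕ × ℕ → ℕ | (∀ i, m i ≤ l i) ∧ (∀ c, c ∉ skewCells l m → T c = 0) ∧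
      IsLRFilling (skewCells l m) ν T}.Finite := by
    have : Finite (skewCells l m) := hγ
    have hpi : (Set.univ.pi fun _ : skewCells l m => Set.Iic L).Finite :=
      Set.Finite.pi fun _ => Set.finite_Iic L
    refine Set.Finite.of_injOn (f := fun T (c : skewCells l m) => T c.1) ?_ ?_ hpi
    · intro T hT c _
      exact hT.2.2.le_of_forall_eq_zero hγ hL c.2
    · intro T hT T' hT' h
      funext c
      by_cases hc : c ∈ skewCells l m
      · exact congrFun h ⟨c, hc⟩
      · rw [hT.2.1 c hc, hT'.2.1 c hc]
  rw [LRcoeff, Set.ncard_pos hfin]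
  constructor
  · rintro ⟨T, h, -, hT⟩
    exact ⟨h, T, hT⟩
  · rintro ⟨h, T, hT⟩
    refine ⟨fun c => if c ∈ skewCells l m then T c else 0, h, fun c hc => if_neg hc,
      hT.congr fun c hc => if_pos hc⟩

lemma mem_starOp_iff {A B : Set (ℕ → ℕ)} (hB : ∀ ν ∈ B, IsPartition ν) {l : ℕ → ℕ} :
    l ∈ starOp A B ↔ IsPartition l ∧ ∃ μ ∈ A, ∃ ν ∈ B,
      (∀ i, μ i ≤ l i) ∧ ∃ T, IsLRFilling (skewCells l μ) ν T := by
  refine and_congr_right fun hl => exists_congr fun μ => and_congr_right fun _ =>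
    exists_congr fun ν => and_congr_right fun hν => LRcoeff_pos_iff hl (hB ν hν)

lemma IsLRFilling.psize_eq {l μ ν : ℕ → ℕ} {T : ℕ × ℕ → ℕ} (hl : IsPartition l)
    (hν : IsPartition ν) (hμl : ∀ i, μ i ≤ l i)
    (h : IsLRFilling (skewCells l μ) ν T) : psize l = psize μ + psize ν := by
  have hγ := finite_skewCells hl μ
  have hcells : cellsOf l = cellsOf μ ∪ skewCells l μ := by
    ext ⟨i, j⟩
    have := hμl i
    simp only [cellsOf, skewCells, Set.mem_ofPred_eq, Set.mem_union]
    omega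
  have hdisj : Disjoint (cellsOf μ) (skewCells l μ) :=
    Set.disjoint_left.2 fun p h1 h2 => absurd h2.1 (not_le.2 h1)
  have hμfin : (cellsOf μ).Finite :=
    hl.finite_cellsOf.subset (hcells ▸ Set.subset_union_left)
  obtain ⟨-, L, hL⟩ := hν
  have hsk : (skewCells l μ).ncard = ∑ j ∈ Finset.range L, ν j := by
    rw [Set.ncard_eq_toFinset_card _ hγ,
      Finset.card_eq_sum_card_fiberwise (f := fun c => T c - 1) (t := Finset.range L)]
    · refine Finset.sum_congr rfl fun j _ => ?_
      rw [show ν j = ν (j + 1 - 1) from rfl, ← h.weight (j + 1) (by omega),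
        ← Set.ncard_coe_finset]
      congr 1
      ext c
      simp only [Finset.coe_filter, Set.Finite.mem_toFinset, Set.mem_ofPred_eq]
      refine and_congr_right fun hc => ?_
      have := h.pos c hc
      omega
    · intro c hc
      have hc' : c ∈ skewCells l μ := by simpa using hc
      have h1 := h.pos c hc'
      have h2 := h.le_of_forall_eq_zero hγ hL hc'
      simp
      omega
  rw [psize, hcells, Set.ncard_union_eq hdisj hμfin hγ, hsk, psize_eq_sum hL, psize]

lemma IsLRFilling.row_zero_eq_one {l μ ν : ℕ → ℕ} {T : ℕ × ℕ → ℕ} (hl : IsPartition l)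
    (h : IsLRFilling (skewCells l μ) ν T) {j : ℕ} (hj : (0, j) ∈ skewCells l μ) :
    T (0, j) = 1 :=
  le_antisymm (h.le_row (finite_skewCells hl μ) 0 j hj) (h.pos _ hj)

lemma ncard_skewCells_row_zero (l μ : ℕ → ℕ) :
    {c ∈ skewCells l μ | c.1 = 0}.ncard = l 0 - μ 0 := by
  rw [show {c ∈ skewCells l μ | c.1 = 0} =
    {p : ℕ × ℕ | p.1 < 1 ∧ μ p.1 ≤ p.2 ∧ p.2 < l p.1} by
      ext ⟨i, j⟩; simp [skewCells, and_comm], ncard_band]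
  simp

lemma IsLRFilling.first_row_le {l μ ν : ℕ → ℕ} {T : ℕ × ℕ → ℕ} (hl : IsPartition l)
    (h : IsLRFilling (skewCells l μ) ν T) : l 0 ≤ μ 0 + ν 0 := by
  have hsub : {c ∈ skewCells l μ | c.1 = 0} ⊆ {c ∈ skewCells l μ | T c = 1} := by
    rintro ⟨i, j⟩ ⟨hc, rfl⟩
    exact ⟨hc, h.row_zero_eq_one hl hc⟩
  have := Set.ncard_le_ncard hsub ((finite_skewCells hl μ).subset fun _ hd => hd.1)
  rw [ncard_skewCells_row_zero, h.weight 1 le_rfl] at this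
  simp at this
  omega

lemma IsLRFilling.length_le {l μ ν : ℕ → ℕ} {T : ℕ × ℕ → ℕ} (hl : IsPartition l)
    (h : IsLRFilling (skewCells l μ) ν T) {a b : ℕ} (hμ : ∀ i, a ≤ i → μ i = 0)
    (hν : ∀ i, b ≤ i → ν i = 0) : ∀ i, a + b ≤ i → l i = 0 := by
  have key : ∀ k, 0 < l (a + k) → k + 1 ≤ T (a + k, 0) := by
    intro k
    induction k with
    | zero => intro hk; exact h.pos _ ⟨(hμ _ (by simp)).le, hk⟩
    | succ k ih =>
      intro hk
      have hk' : 0 < l (a + k) := hk.trans_le (hl.1 (by omega))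
      have := h.col_strict (a + k) (a + (k + 1)) 0 ⟨(hμ _ (by simp)).le, hk'⟩
        ⟨(hμ _ (by simp)).le, hk⟩ (by omega)
      have := ih hk'
      omega
  intro i hi
  by_contra hne
  obtain ⟨k, rfl⟩ : ∃ k, i = a + k := ⟨i - a, by omega⟩
  have h1 := key k (by omega)
  have h2 := h.le_of_forall_eq_zero (finite_skewCells hl μ) hν
    (c := (a + k, 0)) ⟨(hμ _ (by simp)).le, by simp; omega⟩
  omega

lemma starOp_Bset_subset {A B : Set (ℕ → ℕ)} {m q t s : ℕ} (hA : A ⊆ Bset m t)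
    (hB : B ⊆ Bset q s) : starOp A B ⊆ Bset (m + q) (t + s) := by
  intro l hlX
  obtain ⟨hl, μ, hμ, ν, hν, hle, T, hT⟩ :=
    (mem_starOp_iff fun ν hν => (mem_Bset_iff.1 (hB hν)).1).1 hlX
  obtain ⟨-, hμs, hμ0, hμz⟩ := mem_Bset_iff.1 (hA hμ)
  obtain ⟨hνp, hνs, hν0, hνz⟩ := mem_Bset_iff.1 (hB hν)
  refine mem_Bset_iff.2 ⟨hl, ?_, ?_, hT.length_le hl hμz hνz⟩
  · rw [hT.psize_eq hl hνp hle, hμs, hνs]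
  · have := hT.first_row_le hl
    omega

/-! ### Removing and adding the first row of a filling -/

/-- The map moving every cell one row down. -/
def shiftDown (p : ℕ × ℕ) : ℕ × ℕ := (p.1 + 1, p.2)

lemma shiftDown_injective : Function.Injective shiftDown := by
  rintro ⟨a, b⟩ ⟨c, d⟩ h
  simpa [shiftDown] using h

lemma shiftDown_mem_skewCells {l μ : ℕ → ℕ} {a b : ℕ} {c : ℕ × ℕ} :
    shiftDown c ∈ skewCells (consPart a l) (consPart b μ) ↔ c ∈ skewCells l μ := Iff.rfl

lemma readBefore_shiftDown {d c : ℕ × ℕ} :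
    readBefore (shiftDown d) (shiftDown c) ↔ readBefore d c := by
  simp [readBefore, shiftDown]

/-- Removing a first row which contains all the entries `1` of a filling. -/
lemma IsLRFilling.of_consPart {l μ ν : ℕ → ℕ} {a b : ℕ} {T : ℕ × ℕ → ℕ}
    (hl : IsPartition (consPart (a + b) l))
    (h : IsLRFilling (skewCells (consPart (a + b) l) (consPart a μ)) (consPart b ν) T) :
    IsLRFilling (skewCells l μ) ν fun c => T (shiftDown c) - 1 := by
  set γ := skewCells (consPart (a + b) l) (consPart a μ) with hγdef
  have hγ : γ.Finite := finite_skewCells hl _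
  have hones : {c ∈ γ | c.1 = 0} = {c ∈ γ | T c = 1} := by
    refine Set.eq_of_subset_of_ncard_le ?_ ?_ (hγ.subset fun _ hd => hd.1)
    · rintro ⟨i, j⟩ ⟨hc, rfl⟩
      exact ⟨hc, h.row_zero_eq_one hl hc⟩
    · rw [ncard_skewCells_row_zero, h.weight 1 le_rfl]
      simp
  have hone : ∀ c ∈ γ, T c = 1 ↔ c.1 = 0 := fun c hc =>
    ⟨fun hT => (hones.symm.subset ⟨hc, hT⟩ : c ∈ {c ∈ γ | c.1 = 0}).2,
      fun h0 => (hones.subset ⟨hc, h0⟩ : c ∈ {c ∈ γ | T c = 1}).2⟩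
  have htwo : ∀ c ∈ skewCells l μ, 2 ≤ T (shiftDown c) := by
    intro c hc
    have hc' : shiftDown c ∈ γ := shiftDown_mem_skewCells.2 hc
    have h1 := h.pos _ hc'
    have h2 := (hone _ hc').not.2 (by simp [shiftDown])
    omega
  have himage : ∀ (j : ℕ) (p : ℕ × ℕ → Prop), 1 ≤ j →
      {d ∈ γ | T d = j + 1 ∧ p d} =
        shiftDown '' {d ∈ skewCells l μ | T (shiftDown d) - 1 = j ∧ p (shiftDown d)} := by
    intro j p hj
    ext ⟨i, k⟩
    constructor
    · rintro ⟨hd, hT, hp⟩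
      have h0 := (hone _ hd).not.1 (by omega)
      obtain ⟨i, rfl⟩ : ∃ r, i = r + 1 := ⟨i - 1, by simp only at h0; omega⟩
      exact ⟨(i, k), ⟨shiftDown_mem_skewCells.1 hd, by simp [shiftDown, hT], hp⟩, rfl⟩
    · rintro ⟨d, ⟨hd, hT, hp⟩, hdk⟩
      rw [← hdk]
      have := htwo d hd
      exact ⟨shiftDown_mem_skewCells.2 hd, by omega, hp⟩
  refine ⟨fun c hc => ?_, fun j hj => ?_, fun i j j' hc hc' hjj' => ?_,
    fun i i' j hc hc' hii' => ?_, fun c hc j hj => ?_⟩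
  · have := htwo c hc
    omega
  · have h1 := h.weight (j + 1) (by omega)
    have h2 := himage j (fun _ => True) hj
    simp only [and_true] at h2
    rw [h2, Set.ncard_image_of_injective _ shiftDown_injective] at h1
    rw [h1]
    obtain ⟨j, rfl⟩ : ∃ r, j = r + 1 := ⟨j - 1, by omega⟩
    simp
  · exact Nat.sub_le_sub_right (h.row_weak (i + 1) j j' hc hc' hjj') 1
  · have h1 := h.col_strict (i + 1) (i' + 1) j hc hc' (by omega)
    have h2 := htwo _ hc
    have h3 := htwo _ hc'
    simp only [shiftDown] at h2 h3 ⊢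
    omega
  · have h1 := h.lattice (shiftDown c) (shiftDown_mem_skewCells.2 hc) (j + 1) (by omega)
    rw [himage (j + 1) _ (by omega), himage j _ hj,
      Set.ncard_image_of_injective _ shiftDown_injective,
      Set.ncard_image_of_injective _ shiftDown_injective] at h1
    simpa only [readBefore_shiftDown] using h1

/-- Adding a first row of entries `1` to a filling. -/
lemma IsLRFilling.consPart {l μ ν : ℕ → ℕ} {a b : ℕ} {T : ℕ × ℕ → ℕ}
    (hl : IsPartition (consPart (a + b) l)) (hν : ν 0 ≤ b)
    (h : IsLRFilling (skewCells l μ) ν T) :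
    IsLRFilling (skewCells (consPart (a + b) l) (consPart a μ)) (consPart b ν)
      fun c => if c.1 = 0 then 1 else T (c.1 - 1, c.2) + 1 := by
  set γ := skewCells (SylowBranching.consPart (a + b) l) (SylowBranching.consPart a μ) with hγdef
  have hγ : γ.Finite := finite_skewCells hl _
  set U : ℕ × ℕ → ℕ := fun c => if c.1 = 0 then 1 else T (c.1 - 1, c.2) + 1 with hU
  have hU0 : ∀ j, U (0, j) = 1 := fun j => rfl
  have hU1 : ∀ i j, U (i + 1, j) = T (i, j) + 1 := fun i j => rfl
  have hones : {c ∈ γ | U c = 1} = {c ∈ γ | c.1 = 0} := by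
    ext ⟨i, j⟩
    refine and_congr_right fun hc => ?_
    cases i with
    | zero => simp [hU0]
    | succ i =>
      have := h.pos (i, j) hc
      simp only [hU1]
      omega
  have himage : ∀ (j : ℕ) (p : ℕ × ℕ → Prop), 1 ≤ j →
      {d ∈ γ | U d = j + 1 ∧ p d} =
        shiftDown '' {d ∈ skewCells l μ | T d = j ∧ p (shiftDown d)} := by
    intro j p hj
    ext ⟨i, k⟩
    constructor
    · rintro ⟨hd, hT, hp⟩
      cases i with
      | zero => rw [hU0] at hT; omega
      | succ i =>
        rw [hU1] at hT
        exact ⟨(i, k), ⟨hd, by omega, hp⟩, rfl⟩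
    · rintro ⟨d, ⟨hd, hT, hp⟩, hdk⟩
      rw [← hdk]
      exact ⟨shiftDown_mem_skewCells.2 hd, by rw [shiftDown, hU1, hT], hp⟩
  have hweight : ∀ j, 1 ≤ j →
      Set.ncard {c ∈ γ | U c = j} = SylowBranching.consPart b ν (j - 1) := by
    intro j hj
    obtain ⟨j, rfl⟩ : ∃ r, j = r + 1 := ⟨j - 1, by omega⟩
    cases j with
    | zero =>
      rw [zero_add, hones, ncard_skewCells_row_zero]
      simp
    | succ j =>
      have h2 := himage (j + 1) (fun _ => True) (by omega)
      simp only [and_true] at h2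
      rw [h2, Set.ncard_image_of_injective _ shiftDown_injective, h.weight (j + 1) (by omega)]
      simp
  refine ⟨fun c hc => ?_, hweight, fun i j j' hc hc' hjj' => ?_,
    fun i i' j hc hc' hii' => ?_, fun c hc j hj => ?_⟩
  · simp only [hU]
    split_ifs <;> omega
  · cases i with
    | zero => simp [hU0]
    | succ i =>
      have := h.row_weak i j j' hc hc' hjj'
      simp only [hU1]
      omega
  · obtain ⟨i', rfl⟩ : ∃ r, i' = r + 1 := ⟨i' - 1, by omega⟩
    have h1 := h.pos (i', j) hc'
    cases i with
    | zero => simp only [hU0, hU1]; omega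
    | succ i =>
      have := h.col_strict i i' j hc hc' (by omega)
      simp only [hU1]
      omega
  · obtain ⟨i, k⟩ := c
    cases i with
    | zero =>
      rw [himage j _ hj]
      have : {d ∈ skewCells l μ | T d = j ∧ readBefore (shiftDown d) (0, k)} = ∅ := by
        ext d
        simp [readBefore, shiftDown]
      simp [this]
    | succ i =>
      obtain ⟨j, rfl⟩ : ∃ r, j = r + 1 := ⟨j - 1, by omega⟩
      cases j with
      | zero =>
        have h1 : {d ∈ γ | U d = 0 + 1 + 1 ∧ readBefore d (i + 1, k)}.ncard ≤ ν 0 := by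
          have hsub : {d ∈ γ | U d = 0 + 1 + 1 ∧ readBefore d (i + 1, k)} ⊆ {d ∈ γ | U d = 2} :=
            fun d hd => ⟨hd.1, hd.2.1⟩
          exact (Set.ncard_le_ncard hsub (hγ.subset fun _ hd => hd.1)).trans
            (hweight 2 (by omega)).le
        have h2 : b ≤ {d ∈ γ | U d = 0 + 1 ∧ readBefore d (i + 1, k)}.ncard := by
          have := hweight 1 le_rfl
          simp only [Nat.sub_self, consPart_zero] at this
          rw [← this]
          refine Set.ncard_le_ncard (fun d hd => ⟨hd.1, hd.2, ?_⟩) (hγ.subset fun _ hd => hd.1)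
          have h0 : d.1 = 0 := (hones.subset hd).2
          left
          simp [h0]
        omega
      | succ j =>
        rw [himage _ _ (by omega), himage _ _ (by omega),
          Set.ncard_image_of_injective _ shiftDown_injective,
          Set.ncard_image_of_injective _ shiftDown_injective]
        have := h.lattice (i, k) hc (j + 1) (by omega)
        simpa only [show (i + 1, k) = shiftDown (i, k) from rfl, readBefore_shiftDown] using this

/-- The only weight of a filling of a Young diagram is its own shape. -/
lemma IsLRFilling.eq_of_zero {l ν : ℕ → ℕ} {T : ℕ × ℕ → ℕ} (hl : IsPartition l)
    (h : IsLRFilling (skewCells l 0) ν T) : l = ν := by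
  have hγ := finite_skewCells hl 0
  have hge : ∀ i j, (i, j) ∈ skewCells l 0 → i + 1 ≤ T (i, j) := by
    intro i
    induction i with
    | zero => exact fun j hj => h.pos _ hj
    | succ i ih =>
      intro j hj
      have hj' : (i, j) ∈ skewCells l 0 := ⟨hj.1, hj.2.trans_le (hl.1 (Nat.le_succ i))⟩
      have h1 := ih j hj'
      have h2 := h.col_strict i (i + 1) j hj' hj (Nat.lt_succ_self i)
      omega
  funext i
  have hw := h.weight (i + 1) (by omega)
  have : {c ∈ skewCells l 0 | T c = i + 1} = Prod.mk i '' ↑(Finset.range (l i)) := by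
    ext ⟨a, b⟩
    constructor
    · rintro ⟨hc, hT⟩
      have h1 := hge a b hc
      have h2 := h.le_row hγ a b hc
      obtain rfl : a = i := by omega
      exact ⟨b, by simpa using hc.2, rfl⟩
    · rintro ⟨b', hb, hab⟩
      obtain ⟨rfl, rfl⟩ := Prod.mk.inj hab
      have hc : (i, b') ∈ skewCells l 0 := ⟨Nat.zero_le _, by simpa using hb⟩
      have h1 := hge i b' hc
      have h2 := h.le_row hγ i b' hc
      exact ⟨hc, by omega⟩
  rw [this, Set.ncard_image_of_injective _ (Prod.mk_right_injective i), Set.ncard_coe_finset,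
    Finset.card_range] at hw
  simpa using hw

/-! ### Row contents of fillings

A Littlewood–Richardson filling is determined by the number `a i j` of entries `j + 1` in row `i`;
the conditions on these numbers are linear inequalities. -/

/-- `a` is the table of row contents of a Littlewood–Richardson filling of `l / μ` of weight `ν`
supported in the first `K` rows. -/
structure IsLRTable (l μ ν : ℕ → ℕ) (K : ℕ) (a : ℕ → ℕ → ℕ) : Prop where
  triangular : ∀ i j, i < j → a i j = 0
  bounded : ∀ i j, K ≤ i → a i j = 0
  row_sum : ∀ i, l i = μ i + ∑ j ∈ Finset.range (i + 1), a i j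
  col_sum : ∀ j, ν j = ∑ i ∈ Finset.range K, a i j
  strict : ∀ i j, μ (i + 1) + ∑ k ∈ Finset.range (j + 1), a (i + 1) k ≤
    μ i + ∑ k ∈ Finset.range j, a i k
  lattice : ∀ i j, ∑ k ∈ Finset.range (i + 1), a k (j + 1) ≤ ∑ k ∈ Finset.range i, a k j

namespace IsLRTable

variable {l μ ν : ℕ → ℕ} {K : ℕ} {a : ℕ → ℕ → ℕ}

lemma mono_bound (h : IsLRTable l μ ν K a) {K' : ℕ} (hK : K ≤ K') : IsLRTable l μ ν K' a where
  triangular := h.triangular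
  bounded i j hi := h.bounded i j (hK.trans hi)
  row_sum := h.row_sum
  col_sum j := by
    rw [h.col_sum]
    refine Finset.sum_subset (by simpa using hK) fun i _ hi => h.bounded i j (by simpa using hi)
  strict := h.strict
  lattice := h.lattice

/-- Tables of row contents can be added. -/
lemma add {l' μ' ν' : ℕ → ℕ} {a' : ℕ → ℕ → ℕ} (h : IsLRTable l μ ν K a)
    (h' : IsLRTable l' μ' ν' K a') : IsLRTable (l + l') (μ + μ') (ν + ν') K (a + a') where
  triangular i j hij := by simp [h.triangular i j hij, h'.triangular i j hij]
  bounded i j hi := by simp [h.bounded i j hi, h'.bounded i j hi]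
  row_sum i := by
    simp only [Pi.add_apply, Finset.sum_add_distrib, h.row_sum i, h'.row_sum i]
    omega
  col_sum j := by simp only [Pi.add_apply, Finset.sum_add_distrib, h.col_sum j, h'.col_sum j]
  strict i j := by
    have h1 := h.strict i j
    have h2 := h'.strict i j
    simp only [Pi.add_apply, Finset.sum_add_distrib]
    omega
  lattice i j := by
    have h1 := h.lattice i j
    have h2 := h'.lattice i j
    simp only [Pi.add_apply, Finset.sum_add_distrib]
    omega

lemma zero : IsLRTable 0 0 0 0 0 := by
  constructor <;> simp

/-- The table of the column `(1^(x+y))` split into `(1^x)` and `(1^y)`. -/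
lemma column (x y : ℕ) : IsLRTable (column (x + y)) (column x) (column y) (x + y)
    fun i j => if i = x + j ∧ j < y then 1 else 0 := by
  have hrow : ∀ i j, ∑ k ∈ Finset.range j, (if i = x + k ∧ k < y then 1 else 0) =
      if x ≤ i ∧ i < x + y ∧ i < x + j then 1 else 0 := by
    intro i j
    rw [← Finset.card_filter]
    split_ifs with h
    · rw [Finset.card_eq_one]
      refine ⟨i - x, ?_⟩
      ext k
      simp
      omega
    · rw [Finset.card_eq_zero, Finset.filter_eq_empty_iff]
      intro k hk
      simp at hk
      omega
  have hcol : ∀ i j, ∑ k ∈ Finset.range i, (if k = x + j ∧ j < y then 1 else 0) =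
      if x + j < i ∧ j < y then 1 else 0 := by
    intro i j
    rw [← Finset.card_filter]
    split_ifs with h
    · rw [Finset.card_eq_one]
      refine ⟨x + j, ?_⟩
      ext k
      simp
      omega
    · rw [Finset.card_eq_zero, Finset.filter_eq_empty_iff]
      intro k hk
      simp at hk
      omega
  refine ⟨fun i j hij => ?_, fun i j hi => ?_, fun i => ?_, fun j => ?_, fun i j => ?_,
    fun i j => ?_⟩
  · exact if_neg (by omega)
  · exact if_neg (by omega)
  · rw [hrow]
    simp only [SylowBranching.column]
    split_ifs <;> omega
  · rw [hcol]
    simp only [SylowBranching.column]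
    split_ifs <;> omega
  · rw [hrow, hrow]
    simp only [SylowBranching.column]
    split_ifs <;> omega
  · rw [hcol, hcol]
    split_ifs <;> omega

/-- The table of the unique filling of a Young diagram. -/
lemma diagonal (hl : IsPartition l) :
    ∃ K, IsLRTable l 0 l K fun i j => if i = j then l i else 0 := by
  obtain ⟨hanti, K, hK⟩ := hl
  refine ⟨K, fun i j hij => ?_, fun i j hi => ?_, fun i => ?_, fun j => ?_, fun i j => ?_,
    fun i j => ?_⟩
  · exact if_neg (by omega)
  · simp [hK i hi]
  · simp
  · rw [Finset.sum_ite_eq' (Finset.range K) j]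
    split_ifs with h
    · rfl
    · exact hK j (by simpa using h)
  · have := hanti (Nat.le_succ i)
    simp only [Finset.sum_ite_eq, Finset.mem_range]
    split_ifs <;> simp <;> omega
  · have := hanti (Nat.le_succ j)
    simp only [Finset.sum_ite_eq', Finset.mem_range]
    split_ifs <;> omega

/-- Adding a long first row to a table. -/
lemma consPart {x y : ℕ} (h : IsLRTable l μ ν K a) (hx : μ 0 ≤ x) (hy : ν 0 ≤ y) :
    ∃ a', IsLRTable (consPart (x + y) l) (consPart x μ) (consPart y ν) (K + 1) a' := by
  set b : ℕ → ℕ → ℕ := fun i j => match i, j with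
    | 0, 0 => y
    | 0, _ + 1 => 0
    | _ + 1, 0 => 0
    | i + 1, j + 1 => a i j with hb
  have b00 : b 0 0 = y := rfl
  have b01 : ∀ j, b 0 (j + 1) = 0 := fun _ => rfl
  have b10 : ∀ i, b (i + 1) 0 = 0 := fun _ => rfl
  have b11 : ∀ i j, b (i + 1) (j + 1) = a i j := fun _ _ => rfl
  have hpart : ∀ i j, ∑ k ∈ Finset.range i, a k j ≤ ν j := by
    intro i j
    rw [(h.mono_bound (le_max_right i K)).col_sum j]
    exact Finset.sum_le_sum_of_subset (by simp)
  refine ⟨b, fun i j hij => ?_, fun i j hi => ?_, fun i => ?_, fun j => ?_, fun i j => ?_,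
    fun i j => ?_⟩
  · obtain ⟨j, rfl⟩ : ∃ r, j = r + 1 := ⟨j - 1, by omega⟩
    cases i with
    | zero => rfl
    | succ i => exact h.triangular i j (by omega)
  · obtain ⟨i, rfl⟩ : ∃ r, i = r + 1 := ⟨i - 1, by omega⟩
    cases j with
    | zero => rfl
    | succ j => exact h.bounded i j (by omega)
  · rw [Finset.sum_range_succ']
    cases i with
    | zero => simp [b00]
    | succ i => simp [b10, b11, h.row_sum i]
  · rw [Finset.sum_range_succ']
    cases j with
    | zero => simp [b00, b10]
    | succ j => simp [b01, b11, h.col_sum j]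
  · rw [Finset.sum_range_succ']
    simp only [b10, b11, consPart_succ, add_zero]
    cases i with
    | zero =>
      cases j with
      | zero => simpa using hx
      | succ j =>
        rw [Finset.sum_range_succ', Finset.sum_range_succ']
        have h1 : ∑ k ∈ Finset.range j, a 0 (k + 1) = 0 :=
          Finset.sum_eq_zero fun k _ => h.triangular 0 (k + 1) (by omega)
        have h2 := hpart 1 0
        simp only [Finset.sum_range_one] at h2
        simp only [h1, b00, consPart_zero]
        omega
    | succ i =>
      cases j with
      | zero =>
        have := h.strict i 0
        simp at this ⊢
        omega
      | succ j =>
        rw [Finset.sum_range_succ' (fun k => b (i + 1) k) j]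
        simpa [b10, b11] using h.strict i j
  · rw [Finset.sum_range_succ']
    simp only [b01, b11, add_zero]
    cases i with
    | zero => simp
    | succ i =>
      cases j with
      | zero =>
        rw [Finset.sum_range_succ' (fun k => b k 0) i]
        have := hpart (i + 1) 0
        simp only [b10, b00, Finset.sum_const_zero]
        omega
      | succ j =>
        rw [Finset.sum_range_succ' (fun k => b k (j + 1)) i]
        simpa [b01, b11] using h.lattice i j

/-- A table of row contents comes from a filling. -/
lemma exists_isLRFilling (h : IsLRTable l μ ν K a) :
    ∃ T, IsLRFilling (skewCells l μ) ν T := by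
  set E : ℕ → ℕ → ℕ := fun i j => μ i + ∑ k ∈ Finset.range j, a i k with hE
  have hE0 : ∀ i, E i 0 = μ i := fun i => by simp [hE]
  have hEsucc : ∀ i j, E i (j + 1) = E i j + a i j := fun i j => by
    simp [hE, Finset.sum_range_succ, add_assoc]
  have hEmono : ∀ i, Monotone (E i) := fun i =>
    monotone_nat_of_le_succ fun j => by rw [hEsucc]; omega
  have hEl : ∀ i, E i (i + 1) = l i := fun i => (h.row_sum i).symm
  have hElast : ∀ i j, E i j ≤ l i := by
    intro i j
    rw [← hEl]
    rcases le_total j (i + 1) with hj | hj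
    · exact hEmono i hj
    · refine le_of_eq ?_
      simp only [hE]
      congr 1
      refine (Finset.sum_subset (by simpa using hj) fun k _ hk => h.triangular i k ?_).symm
      simp at hk
      omega
  have hEK : ∀ i j, K ≤ i → E i j = μ i := fun i j hi => by simp [hE, h.bounded i _ hi]
  set T : ℕ × ℕ → ℕ := fun c => sInf {j | c.2 < E c.1 j} with hT
  have hle : ∀ i c k, c < l i → (T (i, c) ≤ k ↔ c < E i k) := by
    intro i c k hc
    have hne : {j | c < E i j}.Nonempty := ⟨i + 1, by simpa [hEl] using hc⟩
    refine ⟨fun hk => ?_, fun hk => Nat.sInf_le hk⟩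
    have : c < E i (T (i, c)) := Nat.sInf_mem hne
    exact this.trans_le (hEmono i hk)
  have heq : ∀ i c j, μ i ≤ c → c < l i → (T (i, c) = j + 1 ↔ E i j ≤ c ∧ c < E i (j + 1)) := by
    intro i c j _ hc
    have h1 := hle i c j hc
    have h2 := hle i c (j + 1) hc
    omega
  have hset : ∀ j, {c ∈ skewCells l μ | T c = j + 1} =
      {p : ℕ × ℕ | p.1 < K ∧ E p.1 j ≤ p.2 ∧ p.2 < E p.1 (j + 1)} := by
    intro j
    ext ⟨i, c⟩
    constructor
    · rintro ⟨⟨h1, h2⟩, h3⟩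
      have h4 := (heq i c j h1 h2).1 h3
      refine ⟨?_, h4⟩
      by_contra hi
      have h5 := hEK i (j + 1) (by simpa using hi)
      simp only at h1
      omega
    · rintro ⟨-, h4⟩
      have h1 : μ i ≤ c := (hE0 i ▸ hEmono i (Nat.zero_le j)).trans h4.1
      have h2 : c < l i := h4.2.trans_le (hElast i _)
      exact ⟨⟨h1, h2⟩, (heq i c j h1 h2).2 h4⟩
  have hcard : ∀ L j, {p : ℕ × ℕ | p.1 < L ∧ E p.1 j ≤ p.2 ∧ p.2 < E p.1 (j + 1)}.ncard =
      ∑ i ∈ Finset.range L, a i j := by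
    intro L j
    rw [ncard_band L (fun i => E i j) fun i => E i (j + 1)]
    exact Finset.sum_congr rfl fun i _ => by rw [hEsucc]; omega
  refine ⟨T, fun c hc => ?_, fun j hj => ?_, fun i c c' hc hc' hcc' => ?_, ?_, fun c hc j hj => ?_⟩
  · by_contra h0
    have h1 := (hle c.1 c.2 0 hc.2).1 (by simpa using h0)
    rw [hE0] at h1
    exact absurd hc.1 (not_le.2 h1)
  · obtain ⟨j, rfl⟩ : ∃ r, j = r + 1 := ⟨j - 1, by omega⟩
    rw [hset, hcard, Nat.add_sub_cancel, h.col_sum]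
  · rw [hle i c _ hc.2]
    exact hcc'.trans_lt ((hle i c' _ hc'.2).1 le_rfl)
  · have hμ : Antitone μ := antitone_nat_of_succ_le fun i => by
      have := h.strict i 0
      simp at this
      omega
    have hl : Antitone l := antitone_nat_of_succ_le fun i => by
      have h1 := h.strict i (i + 1)
      rw [h.row_sum i, h.row_sum (i + 1)]
      exact h1
    intro i i' c hc hc' hii'
    obtain ⟨r, rfl⟩ : ∃ r, i' = i + r + 1 := ⟨i' - i - 1, by omega⟩
    have hsucc : ∀ k, (k, c) ∈ skewCells l μ → (k + 1, c) ∈ skewCells l μ →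
        T (k, c) < T (k + 1, c) := by
      intro k hk hk'
      obtain ⟨j, hj⟩ : ∃ j, T (k + 1, c) = j + 1 := by
        refine ⟨T (k + 1, c) - 1, ?_⟩
        have h0 := hle (k + 1) c 0 hk'.2
        have h1 := hk'.1
        rw [hE0] at h0
        simp only at h1
        omega
      have h1 := (hle (k + 1) c (j + 1) hk'.2).1 hj.le
      have h2 := (hle k c j hk.2).2 (h1.trans_le (h.strict k j))
      omega
    have hmem : ∀ k, i ≤ k → k ≤ i + r + 1 → (k, c) ∈ skewCells l μ := fun k h1 h2 =>
      ⟨(hμ h1).trans hc.1, hc'.2.trans_le (hl h2)⟩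
    clear hii' hc'
    induction r with
    | zero => exact hsucc i hc (hmem _ (by omega) le_rfl)
    | succ r ih =>
      exact (ih fun k h1 h2 => hmem k h1 (by omega)).trans
        (hsucc _ (hmem _ (by omega) (by omega)) (hmem _ (by omega) le_rfl))
  · obtain ⟨j, rfl⟩ : ∃ r, j = r + 1 := ⟨j - 1, by omega⟩
    have hup : {d ∈ skewCells l μ | T d = j + 1 + 1 ∧ readBefore d c} ⊆
        {p : ℕ × ℕ | p.1 < c.1 + 1 ∧ E p.1 (j + 1) ≤ p.2 ∧ p.2 < E p.1 (j + 1 + 1)} := by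
      rintro d ⟨hd, hTd, hb⟩
      refine ⟨?_, (heq d.1 d.2 (j + 1) hd.1 hd.2).1 hTd⟩
      rcases hb with hb | hb <;> omega
    have hdown : {p : ℕ × ℕ | p.1 < c.1 ∧ E p.1 j ≤ p.2 ∧ p.2 < E p.1 (j + 1)} ⊆
        {d ∈ skewCells l μ | T d = j + 1 ∧ readBefore d c} := by
      rintro ⟨i, k⟩ ⟨hi, h4⟩
      have h1 : μ i ≤ k := (hE0 i ▸ hEmono i (Nat.zero_le j)).trans h4.1
      have h2 : k < l i := h4.2.trans_le (hElast i _)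
      exact ⟨⟨h1, h2⟩, (heq i k j h1 h2).2 h4, Or.inl hi⟩
    have hfin : {d ∈ skewCells l μ | T d = j + 1 ∧ readBefore d c}.Finite :=
      (hset j ▸ finite_band K (fun i => E i j) fun i => E i (j + 1) :
        {c ∈ skewCells l μ | T c = j + 1}.Finite).subset fun d hd => ⟨hd.1, hd.2.1⟩
    calc _ ≤ _ := Set.ncard_le_ncard hup
            (finite_band (c.1 + 1) (fun i => E i (j + 1)) fun i => E i (j + 1 + 1))
      _ = _ := hcard _ _
      _ ≤ _ := h.lattice c.1 j
      _ = _ := (hcard _ _).symm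
      _ ≤ _ := Set.ncard_le_ncard hdown hfin

end IsLRTable

/-- There is a table of row contents of a filling of `l / μ` of weight `ν`. -/
def HasLRTable (l μ ν : ℕ → ℕ) : Prop := ∃ K a, IsLRTable l μ ν K a

lemma HasLRTable.add_column {l μ ν : ℕ → ℕ} (h : HasLRTable l μ ν) (x y : ℕ) :
    HasLRTable (l + column (x + y)) (μ + column x) (ν + column y) := by
  obtain ⟨K, a, h⟩ := h
  exact ⟨_, _, (h.mono_bound (le_max_left K (x + y))).add
    ((IsLRTable.column x y).mono_bound (le_max_right K (x + y)))⟩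

lemma HasLRTable.consPart {l μ ν : ℕ → ℕ} (h : HasLRTable l μ ν) {x y : ℕ} (hx : μ 0 ≤ x)
    (hy : ν 0 ≤ y) :
    HasLRTable (consPart (x + y) l) (consPart x μ) (consPart y ν) := by
  obtain ⟨K, a, h⟩ := h
  exact ⟨_, h.consPart hx hy⟩

lemma HasLRTable.mem_starOp {A B : Set (ℕ → ℕ)} {l μ ν : ℕ → ℕ} (h : HasLRTable l μ ν)
    (hl : IsPartition l) (hμ : μ ∈ A) (hν : ν ∈ B) (hνp : IsPartition ν) : l ∈ starOp A B := by
  obtain ⟨K, a, h⟩ := h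
  exact ⟨hl, μ, hμ, ν, hν, (LRcoeff_pos_iff hl hνp).2
    ⟨fun i => by rw [h.row_sum]; omega, h.exists_isLRFilling⟩⟩

lemma mem_starOp_Pset_zero_iff {S : Set (ℕ → ℕ)} (hS : ∀ ν ∈ S, IsPartition ν) {l : ℕ → ℕ} :
    l ∈ starOp (Pset 0) S ↔ l ∈ S := by
  constructor
  · intro h
    obtain ⟨hl, μ, ⟨hμ, hμ0⟩, ν, hν, -, T, hT⟩ := (mem_starOp_iff hS).1 h
    obtain rfl : μ = 0 := funext fun i => hμ.eq_zero_of_psize_le (by omega)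
    rwa [hT.eq_of_zero hl]
  · intro h
    obtain ⟨K, hK⟩ := IsLRTable.diagonal (hS l h)
    exact HasLRTable.mem_starOp ⟨K, _, hK⟩ (hS l h) ⟨isPartition_zero, psize_zero⟩ h (hS l h)

/-! ### Splitting columns -/

/-- The partition whose multiset of column lengths is `C`. -/
def ofColumns (C : Multiset ℕ) : ℕ → ℕ := fun i => C.countP (i < ·)

lemma ofColumns_cons (c : ℕ) (C : Multiset ℕ) :
    ofColumns (c ::ₘ C) = ofColumns C + column c := by
  funext i
  simp [ofColumns, column, Multiset.countP_cons]

lemma ofColumns_map_succ (C : Multiset ℕ) :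
    ofColumns (C.map (· + 1)) = consPart C.card (ofColumns C) := by
  funext i
  cases i with
  | zero => simp [ofColumns, Multiset.countP_map]
  | succ i =>
    simp only [ofColumns, consPart_succ, Multiset.countP_map, Nat.add_lt_add_iff_right]
    rw [Multiset.countP_eq_card_filter]

lemma sum_le_card {C : Multiset ℕ} (h : ∀ c ∈ C, c ≤ 1) : C.sum ≤ C.card := by
  simpa using Multiset.sum_le_card_nsmul C 1 h

/-- Every partition of `x + y` occurs in the product of a partition of `x` and one of `y`. -/
lemma exists_hasLRTable_of_sum_eq (C : Multiset ℕ) : ∀ x y, C.sum = x + y →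
    ∃ μ ν, μ ∈ Pset x ∧ ν ∈ Pset y ∧ HasLRTable (ofColumns C) μ ν := by
  induction C using Multiset.induction_on with
  | empty =>
    intro x y h
    rw [Multiset.sum_zero] at h
    obtain rfl : x = 0 := by omega
    obtain rfl : y = 0 := by omega
    exact ⟨0, 0, ⟨isPartition_zero, psize_zero⟩, ⟨isPartition_zero, psize_zero⟩, 0, 0,
      IsLRTable.zero⟩
  | cons c C ih =>
    intro x y h
    rw [Multiset.sum_cons] at h
    obtain ⟨u, v, x', y', hc, hx, hy⟩ :
        ∃ u v x' y', c = u + v ∧ x = x' + u ∧ y = y' + v := by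
      rcases le_total c x with hcx | hcx
      · exact ⟨c, 0, x - c, y, by omega, by omega, by omega⟩
      · exact ⟨x, c - x, 0, y - (c - x), by omega, by omega, by omega⟩
    obtain ⟨μ, ν, ⟨hμ, hμs⟩, ⟨hν, hνs⟩, hT⟩ := ih x' y' (by omega)
    refine ⟨μ + column u, ν + column v, ⟨hμ.add_column u, ?_⟩, ⟨hν.add_column v, ?_⟩, ?_⟩
    · rw [psize_add_column hμ, hμs, hx]
    · rw [psize_add_column hν, hνs, hy]
    · rw [ofColumns_cons, hc]
      exact hT.add_column u v

/-- The partition with columns `C` occurs in the product of some element of `B_m(t)` and some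
element of `B_q(s)`. -/
def OccursInBalls (C : Multiset ℕ) (m t q s : ℕ) : Prop :=
  ∃ μ ∈ Bset m t, ∃ ν ∈ Bset q s, HasLRTable (ofColumns C) μ ν

lemma Bset_mono {n t t' : ℕ} (h : t ≤ t') : Bset n t ⊆ Bset n t' :=
  fun _ hf => ⟨hf.1, hf.2.1.trans h, hf.2.2.trans h⟩

lemma OccursInBalls.mono {C : Multiset ℕ} {m t q s t' s' : ℕ} (h : OccursInBalls C m t q s)
    (ht : t ≤ t') (hs : s ≤ s') : OccursInBalls C m t' q s' := by
  obtain ⟨μ, hμ, ν, hν, hT⟩ := h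
  exact ⟨μ, Bset_mono ht hμ, ν, Bset_mono hs hν, hT⟩

lemma add_short_column_mem_Bset {m t c : ℕ} {f : ℕ → ℕ} (hf : f ∈ Bset m t) (hc : c ≤ t + 1) :
    f + column c ∈ Bset (m + c) (t + 1) := by
  obtain ⟨hp, hs, h0, hz⟩ := mem_Bset_iff.1 hf
  refine mem_Bset_iff.2 ⟨hp.add_column c, by rw [psize_add_column hp, hs], ?_, fun i hi => ?_⟩
  · simp only [Pi.add_apply, column]
    split_ifs <;> omega
  · have := hz i (by omega)
    simp only [Pi.add_apply, column]
    split_ifs <;> omega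

lemma add_column_zero (f : ℕ → ℕ) : f + column 0 = f := by
  funext i
  simp [column]

lemma OccursInBalls.cons_left {C : Multiset ℕ} {m t q s c : ℕ} (h : OccursInBalls C m t q s)
    (hc : c ≤ t + 1) : OccursInBalls (c ::ₘ C) (m + c) (t + 1) q s := by
  obtain ⟨μ, hμ, ν, hν, hT⟩ := h
  refine ⟨_, add_short_column_mem_Bset hμ hc, ν, hν, ?_⟩
  simpa [ofColumns_cons, add_column_zero] using hT.add_column c 0

lemma OccursInBalls.cons_right {C : Multiset ℕ} {m t q s c : ℕ} (h : OccursInBalls C m t q s)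
    (hc : c ≤ s + 1) : OccursInBalls (c ::ₘ C) m t (q + c) (s + 1) := by
  obtain ⟨μ, hμ, ν, hν, hT⟩ := h
  refine ⟨μ, hμ, _, add_short_column_mem_Bset hν hc, ?_⟩
  simpa [ofColumns_cons, add_column_zero] using hT.add_column 0 c

/-- The case of a first row of maximal length. -/
lemma occursInBalls_of_card_eq {C : Multiset ℕ} {m t q s : ℕ} (htm : t ≤ m) (hmt : m < 2 * t)
    (hsq : s ≤ q) (hqs : q < 2 * s) (hpos : ∀ c ∈ C, 0 < c) (hsum : C.sum = m + q)
    (hcard : C.card = t + s) : OccursInBalls C m t q s := by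
  have hC : C = (C.map (· - 1)).map (· + 1) := by
    rw [Multiset.map_map]
    conv_lhs => rw [← Multiset.map_id C]
    refine Multiset.map_congr rfl fun c hc => ?_
    have := hpos c hc
    simp
    omega
  set D := C.map (· - 1) with hD
  have hDcard : D.card = t + s := by rw [hD, Multiset.card_map, hcard]
  have hDsum : D.sum = (m - t) + (q - s) := by
    rw [hC, Multiset.sum_map_add] at hsum
    simp [hDcard] at hsum
    omega
  obtain ⟨μ, ν, ⟨hμ, hμs⟩, ⟨hν, hνs⟩, hT⟩ := exists_hasLRTable_of_sum_eq D _ _ hDsum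
  refine ⟨_, consPart_mem_Bset htm hmt hμ hμs, _, consPart_mem_Bset hsq hqs hν hνs, ?_⟩
  rw [hC, ofColumns_map_succ, hDcard]
  have h1 := hμ.apply_zero_le_psize
  have h2 := hν.apply_zero_le_psize
  exact hT.consPart (by omega) (by omega)

/-- The case of a column of maximal length. -/
lemma occursInBalls_of_column {D : Multiset ℕ} {m t q s : ℕ} (htm : t ≤ m) (hmt : m < 2 * t)
    (hsq : s ≤ q) (hqs : q < 2 * s) (hsum : (t + s) + D.sum = m + q) :
    OccursInBalls ((t + s) ::ₘ D) m t q s := by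
  obtain ⟨μ, ν, ⟨hμ, hμs⟩, ⟨hν, hνs⟩, hT⟩ :=
    exists_hasLRTable_of_sum_eq D (m - t) (q - s) (by omega)
  refine ⟨_, add_column_mem_Bset htm hmt hμ hμs, _, add_column_mem_Bset hsq hqs hν hνs, ?_⟩
  rw [ofColumns_cons]
  exact hT.add_column t s

/-- The case of two long columns. -/
lemma occursInBalls_of_two_columns {D : Multiset ℕ} {m t q s x y : ℕ} (htm : t + x ≤ m)
    (hmt : m < 2 * t) (hsq : s + y ≤ q) (hqs : q < 2 * s)
    (hsum : (t + y) + ((x + s) + D.sum) = m + q) :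
    OccursInBalls ((t + y) ::ₘ (x + s) ::ₘ D) m t q s := by
  obtain ⟨μ, ν, ⟨hμ, hμs⟩, ⟨hν, hνs⟩, hT⟩ :=
    exists_hasLRTable_of_sum_eq D (m - t - x) (q - s - y) (by omega)
  refine ⟨_, add_column_mem_Bset (by omega) hmt (hμ.add_column x) ?_,
    _, add_column_mem_Bset (by omega) hqs (hν.add_column y) ?_, ?_⟩
  · rw [psize_add_column hμ, hμs]
    omega
  · rw [psize_add_column hν, hνs]
    omega
  · rw [ofColumns_cons, ofColumns_cons]
    have := (hT.add_column x s).add_column t y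
    rwa [add_right_comm ν] at this

/-- The two exceptional columns `t + s - 1` and `t + s - 3`. -/
lemma occursInBalls_pair {m t q s : ℕ} (hm : m + 2 = 2 * t) (hq : q + 2 = 2 * s) (ht : 2 ≤ t)
    (hs : 2 ≤ s) : OccursInBalls ((t + (s - 1)) ::ₘ ((t - 2) + (s - 1)) ::ₘ 0) m t q s := by
  have h0 : HasLRTable (ofColumns 0) 0 0 := ⟨0, 0, IsLRTable.zero⟩
  refine ⟨_, add_column_mem_Bset (by omega) (by omega) (isPartition_zero.add_column (t - 2)) ?_,
    (0 + column (s - 1)) + column (s - 1), mem_Bset_iff.2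
      ⟨(isPartition_zero.add_column _).add_column _, ?_, ?_, fun i hi => ?_⟩, ?_⟩
  · rw [psize_add_column isPartition_zero, psize_zero]
    omega
  · rw [psize_add_column (isPartition_zero.add_column _), psize_add_column isPartition_zero,
      psize_zero]
    omega
  · simp only [Pi.add_apply, column, Pi.zero_apply]
    split_ifs <;> omega
  · simp only [Pi.add_apply, column, Pi.zero_apply]
    split_ifs <;> omega
  · rw [ofColumns_cons, ofColumns_cons]
    exact (h0.add_column _ _).add_column _ _

/-- A partition of `m + q` fitting in a square of side `t + s` occurs in a product of elements of
`B_m(t)` and `B_q(s)`. -/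
lemma occursInBalls (n : ℕ) : ∀ (m t q s : ℕ) (C : Multiset ℕ), t + s = n → t ≤ m → m < 2 * t →
    s ≤ q → q < 2 * s → (∀ c ∈ C, 0 < c) → C.sum = m + q → C.card ≤ t + s →
    (∀ c ∈ C, c ≤ t + s) → OccursInBalls C m t q s := by
  induction n with
  | zero => intro m t q s C; omega
  | succ n ih =>
    intro m t q s C hn htm hmt hsq hqs hpos hsum hcard hmax
    by_cases hcard' : C.card = t + s
    · exact occursInBalls_of_card_eq htm hmt hsq hqs hpos hsum hcard'
    by_cases hmem : t + s ∈ C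
    · obtain ⟨D, rfl⟩ := Multiset.exists_cons_of_mem hmem
      exact occursInBalls_of_column htm hmt hsq hqs (by simpa using hsum)
    have hmax' : ∀ c ∈ C, c < t + s := fun c hc =>
      lt_of_le_of_ne (hmax c hc) fun h => hmem (h ▸ hc)
    by_cases hm2 : m + 2 < 2 * t
    · refine (ih m (t - 1) q s C (by omega) (by omega) (by omega) hsq hqs hpos hsum (by omega)
        fun c hc => ?_).mono (Nat.sub_le t 1) le_rfl
      have := hmax' c hc
      omega
    by_cases hq2 : q + 2 < 2 * s
    · refine (ih m t q (s - 1) C (by omega) htm hmt (by omega) (by omega) hpos hsum (by omega)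
        fun c hc => ?_).mono le_rfl (Nat.sub_le s 1)
      have := hmax' c hc
      omega
    by_cases hleft : ∃ c ∈ C, c + 1 ≤ t ∧ m < 2 * (t - 1) + c
    · obtain ⟨c, hc, hct, hcm⟩ := hleft
      obtain ⟨D, rfl⟩ := Multiset.exists_cons_of_mem hc
      simp only [Multiset.sum_cons, Multiset.card_cons] at hsum hcard hcard'
      have := ih (m - c) (t - 1) q s D (by omega) (by omega) (by omega) hsq hqs
        (fun d hd => hpos d (Multiset.mem_cons_of_mem hd)) (by omega) (by omega) fun d hd => by
          have := hmax' d (Multiset.mem_cons_of_mem hd)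
          omega
      have := this.cons_left (c := c) (by omega)
      rwa [Nat.sub_add_cancel (by omega), Nat.sub_add_cancel (by omega)] at this
    by_cases hright : ∃ c ∈ C, c + 1 ≤ s ∧ q < 2 * (s - 1) + c
    · obtain ⟨c, hc, hcs, hcq⟩ := hright
      obtain ⟨D, rfl⟩ := Multiset.exists_cons_of_mem hc
      simp only [Multiset.sum_cons, Multiset.card_cons] at hsum hcard hcard'
      have := ih m t (q - c) (s - 1) D (by omega) htm hmt (by omega) (by omega)
        (fun d hd => hpos d (Multiset.mem_cons_of_mem hd)) (by omega) (by omega) fun d hd => by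
          have := hmax' d (Multiset.mem_cons_of_mem hd)
          omega
      have := this.cons_right (c := c) (by omega)
      rwa [Nat.sub_add_cancel (by omega), Nat.sub_add_cancel (by omega)] at this
    -- Every column has length `1` or at least `max t s`, and length `1` needs `m`, `q` maximal.
    have hlong : ∀ c ∈ C, (t ≤ c ∨ m + 1 = 2 * t ∧ c = 1) ∧ (s ≤ c ∨ q + 1 = 2 * s ∧ c = 1) := by
      intro c hc
      have h0 := hpos c hc
      have h1 : ¬(c + 1 ≤ t ∧ m < 2 * (t - 1) + c) := fun h => hleft ⟨c, hc, h⟩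
      have h2 : ¬(c + 1 ≤ s ∧ q < 2 * (s - 1) + c) := fun h => hright ⟨c, hc, h⟩
      omega
    by_cases hbig : ∃ c ∈ C, 2 ≤ c
    swap
    · push Not at hbig
      have := sum_le_card fun c hc => Nat.le_of_lt_succ (hbig c hc)
      omega
    obtain ⟨c, hc, hc2⟩ := hbig
    obtain ⟨D, rfl⟩ := Multiset.exists_cons_of_mem hc
    have hcl := hlong c hc
    have hck := hmax' c hc
    simp only [Multiset.sum_cons, Multiset.card_cons] at hsum hcard hcard'
    by_cases hbig : ∃ d ∈ D, 2 ≤ d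
    swap
    · push Not at hbig
      have h1 := sum_le_card fun d hd => Nat.le_of_lt_succ (hbig d hd)
      rcases Multiset.empty_or_exists_mem D with rfl | ⟨d, hd⟩
      · simp at hsum
        omega
      · have h2 := hlong d (Multiset.mem_cons_of_mem hd)
        have h3 := hbig d hd
        omega
    obtain ⟨d, hd, hd2⟩ := hbig
    have hdl := hlong d (Multiset.mem_cons_of_mem hd)
    have hdk := hmax' d (Multiset.mem_cons_of_mem hd)
    obtain ⟨F, rfl⟩ := Multiset.exists_cons_of_mem hd
    simp only [Multiset.sum_cons] at hsum
    by_cases hcd : c - t ≤ q - s ∧ d - s ≤ m - t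
    · have := occursInBalls_of_two_columns (D := F) (m := m) (t := t) (q := q) (s := s)
        (x := d - s) (y := c - t) (by omega) hmt (by omega) hqs (by omega)
      rwa [Nat.add_sub_cancel' (by omega), Nat.sub_add_cancel (by omega)] at this
    by_cases hdc : d - t ≤ q - s ∧ c - s ≤ m - t
    · have := occursInBalls_of_two_columns (D := F) (m := m) (t := t) (q := q) (s := s)
        (x := c - s) (y := d - t) (by omega) hmt (by omega) hqs (by omega)
      rw [Nat.add_sub_cancel' (by omega), Nat.sub_add_cancel (by omega)] at this
      rwa [Multiset.cons_swap]
    have hF : F = 0 := by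
      refine Multiset.eq_zero_of_forall_notMem fun f hf => ?_
      have h1 := hlong f (Multiset.mem_cons_of_mem (Multiset.mem_cons_of_mem hf))
      have h2 := Multiset.le_sum_of_mem hf
      omega
    subst hF
    simp only [Multiset.sum_zero] at hsum
    have hpair := occursInBalls_pair (m := m) (t := t) (q := q) (s := s) (by omega) (by omega)
      (by omega) (by omega)
    rcases lt_or_ge d c with h | h
    · rwa [show t + (s - 1) = c by omega, show (t - 2) + (s - 1) = d by omega] at hpair
    · rw [show t + (s - 1) = d by omega, show (t - 2) + (s - 1) = c by omega] at hpair
      rwa [Multiset.cons_swap]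

/-- The multiset of columns of a partition. -/
lemma IsPartition.exists_ofColumns {l : ℕ → ℕ} (hl : IsPartition l) :
    ∃ C : Multiset ℕ, ofColumns C = l ∧ (∀ c ∈ C, 0 < c) ∧ C.card = l 0 ∧
      ∀ c ∈ C, c ≤ SylowBranching.conj l 0 := by
  refine ⟨(Multiset.range (l 0)).map (SylowBranching.conj l), ?_, ?_, by simp, ?_⟩
  · funext i
    have h1 := hl.1 (Nat.zero_le i)
    have : (Finset.range (l 0)).filter (fun j => j < l i) = Finset.range (l i) := by
      ext j
      simp
      omega
    simp only [ofColumns, Multiset.countP_map, hl.lt_conj_iff]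
    have h2 := congrArg Finset.card this
    rw [Finset.card_range] at h2
    exact h2
  · simp only [Multiset.mem_map, Multiset.mem_range]
    rintro c ⟨j, hj, rfl⟩
    exact (hl.lt_conj_iff 0 j).2 hj
  · simp only [Multiset.mem_map, Multiset.mem_range]
    rintro c ⟨j, hj, rfl⟩
    exact hl.conj.1 (Nat.zero_le j)

lemma isPartition_psize_ofColumns (C : Multiset ℕ) :
    IsPartition (ofColumns C) ∧ psize (ofColumns C) = C.sum := by
  induction C using Multiset.induction_on with
  | empty => exact ⟨isPartition_zero, psize_zero⟩
  | cons c C ih =>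
    rw [ofColumns_cons, psize_add_column ih.1, ih.2, Multiset.sum_cons, add_comm c]
    exact ⟨ih.1.add_column c, rfl⟩

/-- `B_{m+q}(t+s) ⊆ B_m(t) ⋆ B_q(s)` when `m / 2 < t ≤ m` and `q / 2 < s ≤ q`. -/
lemma Bset_subset_starOp {m q t s : ℕ} (htm : t ≤ m) (hmt : m < 2 * t) (hsq : s ≤ q)
    (hqs : q < 2 * s) {B : Set (ℕ → ℕ)} (hB : Bset q s ⊆ B) :
    Bset (m + q) (t + s) ⊆ starOp (Bset m t) B := by
  rintro l ⟨⟨hl, hls⟩, hl0, hlc⟩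
  obtain ⟨C, rfl, hpos, hcard, hle⟩ := hl.exists_ofColumns
  obtain ⟨μ, hμ, ν, hν, hT⟩ := occursInBalls _ m t q s C rfl htm hmt hsq hqs hpos
    ((isPartition_psize_ofColumns C).2.symm.trans hls) (by omega) fun c hc => (hle c hc).trans hlc
  exact hT.mem_starOp hl hμ (hB hν) hν.1.1

/-- let `m, q, t, N` be positive with `m/2 < t ≤ m`,
`q/2 < N − 1` and `N ≤ q`, let `S ⊆ P(q − N)`, and set
`Y = B_q(N−1) ∪ {(N, ν) : ν ∈ S}°` and `X = B_m(t) ⋆ Y`.  Then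
(i) `B_{m+q}(t+N−1) ⊆ X ⊆ B_{m+q}(t+N)`; and (ii) for every partition `μ` of
`(m−t) + (q−N)`, the partition `(t+N, μ)` belongs to `X` iff
`μ ∈ P(m−t) ⋆ S` (interpreted as `μ ∈ S` when `m = t`). -/
theorem star_ball_with_cap (m q t N : ℕ) (hm : 0 < m) (hq : 0 < q)
    (ht : 0 < t) (hN : 0 < N) (h1 : m < 2 * t) (h2 : t ≤ m)
    (h3 : q < 2 * (N - 1)) (h4 : N ≤ q)
    (S : Set (ℕ → ℕ)) (hS : S ⊆ Pset (q - N)) :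
    (Bset (m + q) (t + N - 1) ⊆
        starOp (Bset m t) (Bset q (N - 1) ∪ conjClosure (consPart N '' S)) ∧
      starOp (Bset m t) (Bset q (N - 1) ∪ conjClosure (consPart N '' S)) ⊆
        Bset (m + q) (t + N)) ∧
    (∀ μ : ℕ → ℕ, IsPartition μ → psize μ = (m - t) + (q - N) →
      (consPart (t + N) μ ∈
          starOp (Bset m t) (Bset q (N - 1) ∪ conjClosure (consPart N '' S)) ↔
        μ ∈ (if m = t then S else starOp (Pset (m - t)) S))) := by
  have hSp : ∀ ν ∈ S, IsPartition ν := fun ν hν => (hS hν).1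
  have hcons : ∀ ν ∈ S, consPart N ν ∈ Bset q N := fun ν hν =>
    consPart_mem_Bset h4 (by omega) (hS hν).1 (hS hν).2
  set Y := Bset q (N - 1) ∪ conjClosure (consPart N '' S) with hY
  have hYB : Y ⊆ Bset q N := by
    rintro f (hf | ⟨ν, hν, rfl⟩ | ⟨_, ⟨ν, hν, rfl⟩, rfl⟩)
    · exact Bset_mono (Nat.sub_le N 1) hf
    · exact hcons ν hν
    · exact conj_mem_Bset (hcons ν hν)
  have hYp : ∀ ν ∈ Y, IsPartition ν := fun ν hν => (hYB hν).1.1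
  refine ⟨⟨?_, starOp_Bset_subset subset_rfl hYB⟩, fun μ hμ hμs => ?_⟩
  · rw [Nat.add_sub_assoc hN]
    exact Bset_subset_starOp h2 h1 (by omega) h3 Set.subset_union_left
  have hite : μ ∈ (if m = t then S else starOp (Pset (m - t)) S) ↔
      μ ∈ starOp (Pset (m - t)) S := by
    split_ifs with hmt
    · rw [hmt, Nat.sub_self, mem_starOp_Pset_zero_iff hSp]
    · rfl
  rw [hite, mem_starOp_iff hYp, mem_starOp_iff hSp]
  constructor
  · rintro ⟨hl, α, hα, β, hβ, hle, T, hT⟩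
    obtain ⟨hαp, hαs, hα0, -⟩ := mem_Bset_iff.1 hα
    have hrow := hT.first_row_le hl
    rw [consPart_zero] at hrow
    have hβ0 := (hYB hβ).2.1
    obtain ⟨ν, hν, rfl⟩ : ∃ ν ∈ S, consPart N ν = β := by
      rcases hβ with hβ | hβ | ⟨_, ⟨ν, hν, rfl⟩, rfl⟩
      · have := hβ.2.1
        omega
      · exact hβ
      · have hp := hcons ν hν
        have : conj (consPart N ν) 0 ≤ N - 1 := by
          refine (hp.1.1.conj_zero_le_iff _).2 fun i hi => ?_
          obtain ⟨i, rfl⟩ : ∃ r, i = r + 1 := ⟨i - 1, by omega⟩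
          refine (hS hν).1.eq_zero_of_psize_le ?_
          rw [(hS hν).2]
          omega
        omega
    have hαt : α 0 = t := by omega
    have hαc := consPart_tail α
    rw [hαt] at hαc
    rw [← hαc] at hT hle hαs
    rw [psize_consPart hαp.tail] at hαs
    exact ⟨hμ, _, ⟨hαp.tail, by omega⟩, ν, hν, fun i => hle (i + 1), _, hT.of_consPart hl⟩
  · rintro ⟨-, α, ⟨hα, hαs⟩, ν, hν, hle, T, hT⟩
    have hμ0 := hμ.apply_zero_le_psize
    have hν0 := (hS hν).1.apply_zero_le_psize
    rw [(hS hν).2] at hν0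
    have hl : IsPartition (consPart (t + N) μ) := hμ.consPart (by omega)
    refine ⟨hl, _, consPart_mem_Bset h2 h1 hα hαs, _, Or.inr (Or.inl ⟨ν, hν, rfl⟩), fun i => ?_,
      _, hT.consPart hl (by omega)⟩
    cases i with
    | zero => simp
    | succ i => exact hle i

end SylowBranching
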